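/- Let P be a k-wedge-simple d-dimensional polyhedron and let F be any d'-dimensional face of P with 1 < d' < d. Then F is also k-wedge-simple. -/

import Mathlib

open scoped BigOperators

/-- Data defining a polyhedron `{z ∈ ℝ^d : A z ≥ b}` with rational data.
Under the `IsProper` assumption below it is full-dimensional with an
irredundant description, hence `d`-dimensional with exactly `f` facets. -/
structure PolyData (d f : ℕ) where
  A : Matrix (Fin f) (Fin d) ℚ
  b : Fin f → ℚ

namespace PolyData

variable {d f : ℕ}

/-- The `i`-th row of `A` (outer normal of the `i`-th facet), as a real vector. -/
def row (P : PolyData d f) (i : Fin f) : Fin d → ℝ := fun j => (P.A i j : ℝ)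

/-- The `i`-th right-hand side, as a real number. -/
def rhs (P : PolyData d f) (i : Fin f) : ℝ := (P.b i : ℝ)

/-- Value of the `i`-th linear form at `z`. -/
def eval (P : PolyData d f) (i : Fin f) (z : Fin d → ℝ) : ℝ := ∑ j, P.row i j * z j

/-- The feasible set `{z : A z ≥ b}`. -/
def toSet (P : PolyData d f) : Set (Fin d → ℝ) := {z | ∀ i, P.rhs i ≤ P.eval i z}

/-- Indices of the constraints (facets) active (incident) at `z`. -/
def activeAt (P : PolyData d f) (z : Fin d → ℝ) : Set (Fin f) := {i | P.eval i z = P.rhs i}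

/-- The `i`-th facet, as a subset of the polyhedron. -/
def facet (P : PolyData d f) (i : Fin f) : Set (Fin d → ℝ) :=
  {z ∈ P.toSet | P.eval i z = P.rhs i}

/-- The standing assumption: the polyhedron is full-dimensional and the
description is irredundant, i.e. every inequality is facet-defining. -/
def IsProper (P : PolyData d f) : Prop :=
  (∃ z, ∀ i, P.rhs i < P.eval i z) ∧
  ∀ i, ∃ z ∈ P.toSet, P.eval i z = P.rhs i ∧ ∀ i', i' ≠ i → P.rhs i' < P.eval i' z

/-- A vertex: a feasible point whose active outer normals span `ℝ^d`. -/
def IsVertex (P : PolyData d f) (v : Fin d → ℝ) : Prop :=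
  v ∈ P.toSet ∧ Submodule.span ℝ (P.row '' P.activeAt v) = ⊤

/-- A circuit direction of `P`: a nonzero `g` such that `A g` is
support-minimal in `{A x : x ≠ 0}` (taken here up to scaling). -/
def IsCircuit (P : PolyData d f) (g : Fin d → ℝ) : Prop :=
  g ≠ 0 ∧ ∀ x : Fin d → ℝ, x ≠ 0 →
    {i | P.eval i x ≠ 0} ⊆ {i | P.eval i g ≠ 0} →
    {i | P.eval i x ≠ 0} = {i | P.eval i g ≠ 0}

/-- The set of circuits of `P`. -/
def circuits (P : PolyData d f) : Set (Fin d → ℝ) := {g | P.IsCircuit g}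

/-- A (maximal) circuit walk `y 0, …, y k` of length `k`. -/
def IsCircuitWalk (P : PolyData d f) {k : ℕ} (y : Fin (k+1) → Fin d → ℝ) : Prop :=
  (∀ i, y i ∈ P.toSet) ∧
  ∀ i : Fin k, ∃ g ∈ P.circuits, ∃ α : ℝ, 0 < α ∧
    y i.succ = y i.castSucc + α • g ∧
    ∀ β : ℝ, α < β → y i.castSucc + β • g ∉ P.toSet

/-- The circuit distance from `u` to `v`: minimum length of a circuit walk. -/
noncomputable def circuitDistance (P : PolyData d f) (u v : Fin d → ℝ) : ℕ∞ :=
  sInf {n : ℕ∞ | ∃ k : ℕ, n = (k : ℕ∞) ∧ ∃ y : Fin (k+1) → Fin d → ℝ,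
    P.IsCircuitWalk y ∧ y 0 = u ∧ y (Fin.last k) = v}

/-- The circuit diameter: maximum circuit distance between two vertices. -/
noncomputable def circuitDiameter (P : PolyData d f) : ℕ∞ :=
  ⨆ (u : Fin d → ℝ) (v : Fin d → ℝ) (_ : P.IsVertex u) (_ : P.IsVertex v),
    P.circuitDistance u v

/-- `u` and `v` are joined by an edge of `P`. -/
def IsEdge (P : PolyData d f) (u v : Fin d → ℝ) : Prop :=
  P.IsVertex u ∧ P.IsVertex v ∧ u ≠ v ∧
  segment ℝ u v = {z ∈ P.toSet | P.activeAt u ∩ P.activeAt v ⊆ P.activeAt z}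

/-- An edge walk along vertices of `P`. -/
def IsEdgeWalk (P : PolyData d f) {k : ℕ} (y : Fin (k+1) → Fin d → ℝ) : Prop :=
  ∀ i : Fin k, P.IsEdge (y i.castSucc) (y i.succ)

/-- Combinatorial (edge) distance between two vertices. -/
noncomputable def edgeDistance (P : PolyData d f) (u v : Fin d → ℝ) : ℕ∞ :=
  sInf {n : ℕ∞ | ∃ k : ℕ, n = (k : ℕ∞) ∧ ∃ y : Fin (k+1) → Fin d → ℝ,
    P.IsEdgeWalk y ∧ y 0 = u ∧ y (Fin.last k) = v}

/-- Combinatorial (edge) diameter. -/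
noncomputable def edgeDiameter (P : PolyData d f) : ℕ∞ :=
  ⨆ (u : Fin d → ℝ) (v : Fin d → ℝ) (_ : P.IsVertex u) (_ : P.IsVertex v),
    P.edgeDistance u v

end PolyData

/-- `Δ_E(f,d)`: maximum combinatorial diameter of a `d`-dimensional
polyhedron with `f` facets. -/
noncomputable def maxEdgeDiameter (f d : ℕ) : ℕ∞ :=
  ⨆ (P : PolyData d f) (_ : P.IsProper), P.edgeDiameter

/-- `Δ_C(f,d)`: maximum circuit diameter of a `d`-dimensional polyhedron
with `f` facets. -/
noncomputable def maxCircuitDiameter (f d : ℕ) : ℕ∞ :=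
  ⨆ (P : PolyData d f) (_ : P.IsProper), P.circuitDiameter

/-- `Δ_C^u(f,d)`: maximum circuit diameter of an unbounded `d`-dimensional
polyhedron with `f` facets. -/
noncomputable def maxUnboundedCircuitDiameter (f d : ℕ) : ℕ∞ :=
  ⨆ (P : PolyData d f) (_ : P.IsProper ∧ ¬ Bornology.IsBounded P.toSet),
    P.circuitDiameter

namespace PolyData

variable {d f : ℕ}

/-- A walk is simple if each step enters exactly one new facet. -/
def IsSimpleWalk (P : PolyData d f) {k : ℕ} (y : Fin (k+1) → Fin d → ℝ) : Prop :=
  ∀ i : Fin k, (P.activeAt (y i.succ) \ P.activeAt (y i.castSucc)).ncard = 1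

/-- `P` is `C`-simple: all circuit walks of length at most `Δ_E(f,d)` are simple. -/
def IsCSimple (P : PolyData d f) : Prop :=
  ∀ k : ℕ, (k : ℕ∞) ≤ maxEdgeDiameter f d →
    ∀ y : Fin (k+1) → Fin d → ℝ, P.IsCircuitWalk y → P.IsSimpleWalk y

/-- A non-revisiting walk: each step enters a facet containing no earlier
point of the walk. -/
def IsNonRevisiting (P : PolyData d f) {k : ℕ} (y : Fin (k+1) → Fin d → ℝ) : Prop :=
  ∀ i : Fin k, ∃ j : Fin f, j ∈ P.activeAt (y i.succ) ∧
    ∀ i' : Fin (k+1), i' ≤ i.castSucc → j ∉ P.activeAt (y i')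

/-- `P` is a simple polyhedron: every vertex lies on exactly `d` facets. -/
def IsSimplePoly (P : PolyData d f) : Prop :=
  ∀ v, P.IsVertex v → (P.activeAt v).ncard = d

end PolyData

/-- Append a last coordinate: `(z, t) ∈ ℝ^{d+1}`. -/
def snocVec {d : ℕ} (z : Fin d → ℝ) (t : ℝ) : Fin (d+1) → ℝ := Fin.snoc z t

namespace PolyData

variable {d f : ℕ}

/-- `W` is a wedge on `P` over the facet with index `i₀`:
`W = H^≤ ∩ (P × [0,∞))`, where the boundary hyperplane `H = {w : a·w = β}`
of the halfspace `H^≤` contains `P × {0}` on its feasible side, meets the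
interior of `P × [0,∞)`, and meets `P × {0}` exactly in the facet `i₀`. -/
def IsWedgeOver (W : PolyData (d+1) (f+1)) (P : PolyData d f) (i₀ : Fin f) : Prop :=
  ∃ (a : Fin (d+1) → ℝ) (β : ℝ),
    (∀ z ∈ P.toSet, ∑ j, a j * snocVec z 0 j ≤ β) ∧
    (∃ z, (∀ i, P.rhs i < P.eval i z) ∧ ∃ t : ℝ, 0 < t ∧ ∑ j, a j * snocVec z t j = β) ∧
    (∀ z ∈ P.toSet, (∑ j, a j * snocVec z 0 j = β ↔ z ∈ P.facet i₀)) ∧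
    W.toSet = {w | ∑ j, a j * w j ≤ β} ∩
      {w | ∃ z ∈ P.toSet, ∃ t : ℝ, 0 ≤ t ∧ w = snocVec z t}

/-- `P` is wedge-simple: it is `C`-simple and over every facet there is a
`C`-simple wedge. -/
def IsWedgeSimple (P : PolyData d f) : Prop :=
  P.IsCSimple ∧ ∀ i₀ : Fin f, ∃ W : PolyData (d+1) (f+1),
    W.IsProper ∧ W.IsWedgeOver P i₀ ∧ W.IsCSimple

end PolyData

/-- `k`-wedge-simplicity: `0`-wedge-simple means `C`-simple, and `P` is
`(k+1)`-wedge-simple if it is `C`-simple and over every facet there is a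
`k`-wedge-simple wedge.  In particular `1`-wedge-simple = wedge-simple. -/
def IsKWedgeSimpleAux : ℕ → (d f : ℕ) → PolyData d f → Prop
  | 0, _, _, P => P.IsCSimple
  | (k+1), d, f, P => P.IsCSimple ∧ ∀ i₀ : Fin f,
      ∃ W : PolyData (d+1) (f+1), W.IsProper ∧ W.IsWedgeOver P i₀ ∧
        IsKWedgeSimpleAux k (d+1) (f+1) W

def IsKWedgeSimple (k : ℕ) {d f : ℕ} (P : PolyData d f) : Prop :=
  IsKWedgeSimpleAux k d f P

namespace PolyData

variable {d : ℕ}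

/-- `(P, u, v)` is a Dantzig figure: a `d`-dimensional polyhedron with `2d`
facets, `d` of which are incident to the vertex `u` and the other `d` to the
vertex `v`. -/
def IsDantzigFigure (P : PolyData d (2*d)) (u v : Fin d → ℝ) : Prop :=
  P.IsVertex u ∧ P.IsVertex v ∧ Disjoint (P.activeAt u) (P.activeAt v) ∧
  P.activeAt u ∪ P.activeAt v = Set.univ ∧
  (P.activeAt u).ncard = d ∧ (P.activeAt v).ncard = d

end PolyData

/-- The (exposed) faces of a polyhedron, each obtained by turning a subset of
the inequalities into equations. -/
def PolyData.faces {d f : ℕ} (P : PolyData d f) : Set (Set (Fin d → ℝ)) :=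
  {F | ∃ S : Set (Fin f), F = {z ∈ P.toSet | S ⊆ P.activeAt z}}

/-- Combinatorial equivalence: an inclusion-preserving bijection between the
face lattices. -/
def CombEquiv {d f d' f' : ℕ} (P : PolyData d f) (Q : PolyData d' f') : Prop :=
  ∃ φ : Set (Fin d → ℝ) → Set (Fin d' → ℝ),
    Set.BijOn φ P.faces Q.faces ∧
    ∀ F ∈ P.faces, ∀ G ∈ P.faces, (F ⊆ G ↔ φ F ⊆ φ G)

/-- Two facets are adjacent if they share a ridge (a codimension-2 face). -/
def PolyData.AdjacentFacets {d f : ℕ} (P : PolyData d f) (i j : Fin f) : Prop :=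
  i ≠ j ∧ Module.finrank ℝ (affineSpan ℝ (P.facet i ∩ P.facet j)).direction = d - 2

/-- The Klee–Walkup polyhedron `U_4`. -/
def U4 : PolyData 4 8 where
  A := !![-6,-3,0,1; -3,-6,1,0; -35,-45,6,3; -45,-35,3,6;
          1,0,0,0; 0,1,0,0; 0,0,1,0; 0,0,0,1]
  b := ![-1,-1,-8,-8,0,0,0,0]

namespace PolyData

variable {d f d' f' : ℕ}

theorem eval_add (P : PolyData d f) (i : Fin f) (x y : Fin d → ℝ) :
    P.eval i (x + y) = P.eval i x + P.eval i y :=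
  dotProduct_add (P.row i) x y

theorem eval_smul (P : PolyData d f) (i : Fin f) (c : ℝ) (x : Fin d → ℝ) :
    P.eval i (c • x) = c * P.eval i x :=
  dotProduct_smul c (P.row i) x

theorem eval_sub (P : PolyData d f) (i : Fin f) (x y : Fin d → ℝ) :
    P.eval i (x - y) = P.eval i x - P.eval i y :=
  dotProduct_sub (P.row i) x y

/-- The `i`-th linear form of a polyhedron, as a bundled linear map. -/
def evalLin (P : PolyData d f) (i : Fin f) : (Fin d → ℝ) →ₗ[ℝ] ℝ where
  toFun := P.eval i
  map_add' := P.eval_add i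
  map_smul' := P.eval_smul i

theorem exists_pos_add_smul_mem (P : PolyData d f) {z x : Fin d → ℝ} (hz : z ∈ P.toSet)
    (hx : ∀ i ∈ P.activeAt z, 0 ≤ P.eval i x) : ∃ ε : ℝ, 0 < ε ∧ z + ε • x ∈ P.toSet := by
  have key : ∀ i, ∀ᶠ ε in nhdsWithin (0 : ℝ) (Set.Ioi 0), P.rhs i ≤ P.eval i (z + ε • x) := by
    intro i
    by_cases hi : i ∈ P.activeAt z
    · filter_upwards [self_mem_nhdsWithin] with ε hε
      have h1 : P.eval i z = P.rhs i := hi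
      have h2 := mul_nonneg (le_of_lt (Set.mem_Ioi.1 hε)) (hx i hi)
      rw [eval_add, eval_smul]
      linarith
    · have hlt : P.rhs i < P.eval i z := lt_of_le_of_ne (hz i) (Ne.symm hi)
      have hc : Filter.Tendsto (fun ε : ℝ => P.eval i z + ε * P.eval i x)
          (nhdsWithin 0 (Set.Ioi 0)) (nhds (P.eval i z + 0 * P.eval i x)) :=
        (Continuous.tendsto (by fun_prop) 0).mono_left nhdsWithin_le_nhds
      filter_upwards [hc.eventually (lt_mem_nhds (by simpa using hlt))] with ε hε
      rw [eval_add, eval_smul]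
      exact hε.le
  obtain ⟨ε, h1, h2⟩ := ((Filter.eventually_all.2 key).and self_mem_nhdsWithin).exists
  exact ⟨ε, h2, h1⟩

/-- An affine function that is nonnegative on a polyhedron and vanishes at an interior point
has trivial linear part. -/
theorem linear_eq_zero_of_nonneg (Q : PolyData d f) {h : (Fin d → ℝ) → ℝ}
    {l : (Fin d → ℝ) →ₗ[ℝ] ℝ} (hl : ∀ q v, h (q + v) = h q + l v)
    (hnonneg : ∀ q ∈ Q.toSet, 0 ≤ h q) {q₀ : Fin d → ℝ} (hq₀ : ∀ i, Q.rhs i < Q.eval i q₀)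
    (h0 : h q₀ = 0) (v : Fin d → ℝ) : l v = 0 := by
  have key : ∀ v, 0 ≤ l v := by
    intro v
    obtain ⟨ε, hε, hm⟩ := Q.exists_pos_add_smul_mem (z := q₀) (x := v) (fun i => (hq₀ i).le)
      (fun i hi => absurd hi (hq₀ i).ne')
    have := hnonneg _ hm
    rw [hl, h0, map_smul, smul_eq_mul, zero_add] at this
    exact nonneg_of_mul_nonneg_right this hε
  have h1 := key v
  have h2 := key (-v)
  rw [map_neg] at h2
  linarith

/-- An affine function that is nonnegative on a polyhedron, positive at an interior point and
zero at a relative interior point of a facet is a positive multiple of the slack of the facet. -/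
theorem exists_pos_eq_mul_slack (Q : PolyData d f) {h : (Fin d → ℝ) → ℝ}
    {l : (Fin d → ℝ) →ₗ[ℝ] ℝ} (hl : ∀ q v, h (q + v) = h q + l v)
    (hnonneg : ∀ q ∈ Q.toSet, 0 ≤ h q) {q₀ : Fin d → ℝ} (hq₀ : ∀ i, Q.rhs i < Q.eval i q₀)
    (h0 : 0 < h q₀) {j : Fin f} {p : Fin d → ℝ} (hp : Q.eval j p = Q.rhs j)
    (hp' : ∀ i, i ≠ j → Q.rhs i < Q.eval i p) (hhp : h p = 0) :
    ∃ c : ℝ, 0 < c ∧ ∀ q, h q = c * (Q.eval j q - Q.rhs j) := by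
  have key : ∀ v, Q.eval j v = 0 → 0 ≤ l v := by
    intro v hv
    have hpm : p ∈ Q.toSet := fun i => by
      by_cases hi : i = j
      · subst hi; exact hp.ge
      · exact (hp' i hi).le
    obtain ⟨ε, hε, hm⟩ := Q.exists_pos_add_smul_mem (z := p) (x := v) hpm
      (fun i hi => by
        by_cases hij : i = j
        · subst hij; exact hv.ge
        · exact absurd hi (hp' i hij).ne')
    have := hnonneg _ hm
    rw [hl, hhp, map_smul, smul_eq_mul, zero_add] at this
    exact nonneg_of_mul_nonneg_right this hε
  have key' : ∀ v, Q.eval j v = 0 → l v = 0 := by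
    intro v hv
    have h1 := key v hv
    have h2 := key (-v) (by rw [← neg_one_smul ℝ, eval_smul, hv, mul_zero])
    rw [map_neg] at h2
    linarith
  have hs : 0 < Q.eval j (q₀ - p) := by
    rw [eval_sub, hp]; linarith [hq₀ j]
  have hlq : l (q₀ - p) = h q₀ := by
    have := hl p (q₀ - p)
    rw [hhp, add_sub_cancel] at this
    linarith
  refine ⟨h q₀ / Q.eval j (q₀ - p), div_pos h0 hs, fun q => ?_⟩
  have hq : h q = l (q - p) := by
    have := hl p (q - p)
    rw [hhp, add_sub_cancel] at this
    linarith
  have h3 := key' ((q - p) - (Q.eval j (q - p) / Q.eval j (q₀ - p)) • (q₀ - p)) (by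
    rw [eval_sub, eval_smul, div_mul_cancel₀ _ hs.ne', sub_self])
  rw [map_sub, map_smul, smul_eq_mul, hlq, ← hq, eval_sub Q j q, hp] at h3
  field_simp at h3 ⊢
  linarith

theorem isExtreme_face (P : PolyData d f) (S : Set (Fin f)) :
    IsExtreme ℝ P.toSet {z ∈ P.toSet | S ⊆ P.activeAt z} := by
  refine ⟨fun z hz => hz.1, fun x hx y hy z hz hxy => ⟨hx, fun i hi => ?_⟩⟩
  obtain ⟨a, b, ha, hb, hab, rfl⟩ := hxy
  have h1 : P.eval i (a • x + b • y) = P.rhs i := hz.2 hi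
  rw [eval_add, eval_smul, eval_smul] at h1
  have h2 := hx i
  have h3 := hy i
  have h4 : a * (P.eval i x - P.rhs i) + b * (P.eval i y - P.rhs i) = 0 := by
    linear_combination h1 - hab * P.rhs i
  have h5 := mul_nonneg hb.le (sub_nonneg.2 h3)
  have h6 : a * (P.eval i x - P.rhs i) ≤ 0 := by linarith
  have h7 : P.eval i x - P.rhs i ≤ 0 := nonpos_of_mul_nonpos_right h6 ha
  exact le_antisymm (by linarith) h2

section Realization

variable {P : PolyData d f} {Q : PolyData d' f'} {T : (Fin d' → ℝ) →ᵃ[ℝ] (Fin d → ℝ)}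

theorem map_add_eq (T : (Fin d' → ℝ) →ᵃ[ℝ] (Fin d → ℝ)) (q v : Fin d' → ℝ) :
    T (q + v) = T q + T.linear v := by
  have := T.map_vadd q v
  simpa [add_comm] using this

theorem eval_comp_add (P : PolyData d f) (T : (Fin d' → ℝ) →ᵃ[ℝ] (Fin d → ℝ)) (i : Fin f)
    (q v : Fin d' → ℝ) :
    P.eval i (T (q + v)) - P.rhs i =
      (P.eval i (T q) - P.rhs i) + ((P.evalLin i).comp T.linear) v := by
  rw [map_add_eq, eval_add]
  change _ = _ + P.eval i (T.linear v)
  ring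

/-- Constraints active at the image of an interior point vanish along the face. -/
theorem eval_linear_eq_zero (hsub : T '' Q.toSet ⊆ P.toSet) {q₀ : Fin d' → ℝ}
    (hq₀ : ∀ i, Q.rhs i < Q.eval i q₀) {i : Fin f} (hi : i ∈ P.activeAt (T q₀))
    (v : Fin d' → ℝ) : P.eval i (T.linear v) = 0 :=
  Q.linear_eq_zero_of_nonneg (P.eval_comp_add T i)
    (fun q hq => sub_nonneg.2 (hsub ⟨q, hq, rfl⟩ i)) hq₀ (sub_eq_zero.2 hi) v

theorem mem_image_of_activeAt_subset (hext : IsExtreme ℝ P.toSet (T '' Q.toSet))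
    {q₀ : Fin d' → ℝ} (hq₀ : ∀ i, Q.rhs i < Q.eval i q₀) {w : Fin d → ℝ} (hw : w ∈ P.toSet)
    (h : P.activeAt (T q₀) ⊆ P.activeAt w) : w ∈ T '' Q.toSet := by
  have hm : T q₀ ∈ T '' Q.toSet := ⟨q₀, fun i => (hq₀ i).le, rfl⟩
  obtain ⟨ε, hε, hy⟩ := P.exists_pos_add_smul_mem (z := T q₀) (x := T q₀ - w) (hext.subset hm)
    (fun i hi => by
      have h1 : P.eval i (T q₀) = P.rhs i := hi
      have h2 : P.eval i w = P.rhs i := h hi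
      rw [eval_sub, h1, h2, sub_self])
  refine hext.left_mem_of_mem_openSegment hw hy hm
    ⟨ε / (1 + ε), 1 / (1 + ε), by positivity, by positivity, by field_simp; ring, ?_⟩
  ext k
  simp only [Pi.add_apply, Pi.smul_apply, Pi.sub_apply, smul_eq_mul]
  field_simp
  ring

theorem mem_range_linear (hext : IsExtreme ℝ P.toSet (T '' Q.toSet))
    {q₀ : Fin d' → ℝ} (hq₀ : ∀ i, Q.rhs i < Q.eval i q₀) {x : Fin d → ℝ}
    (hx : ∀ i ∈ P.activeAt (T q₀), P.eval i x = 0) : ∃ v, T.linear v = x := by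
  have hm : T q₀ ∈ T '' Q.toSet := ⟨q₀, fun i => (hq₀ i).le, rfl⟩
  obtain ⟨ε, hε, hy⟩ := P.exists_pos_add_smul_mem (z := T q₀) (x := x) (hext.subset hm)
    (fun i hi => (hx i hi).ge)
  obtain ⟨q, -, hq⟩ := mem_image_of_activeAt_subset hext hq₀ hy (fun i hi => by
    have h1 : P.eval i (T q₀) = P.rhs i := hi
    change P.eval i _ = _
    rw [eval_add, eval_smul, hx i hi, h1, mul_zero, add_zero])
  refine ⟨ε⁻¹ • (q - q₀), ?_⟩
  have h2 := map_add_eq T q₀ (q - q₀)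
  rw [add_sub_cancel, hq] at h2
  rw [map_smul, ← add_left_cancel h2, smul_smul, inv_mul_cancel₀ hε.ne', one_smul]

/-- Every facet of a face of `P` is cut out by a facet of `P` not containing the face. -/
theorem exists_facet_lift (hT : Function.Injective T) (hQ : Q.IsProper)
    (hext : IsExtreme ℝ P.toSet (T '' Q.toSet))
    {q₀ : Fin d' → ℝ} (hq₀ : ∀ i, Q.rhs i < Q.eval i q₀) (j : Fin f') :
    ∃ i, i ∉ P.activeAt (T q₀) ∧ ∃ c : ℝ, 0 < c ∧
      ∀ q, P.eval i (T q) - P.rhs i = c * (Q.eval j q - Q.rhs j) := by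
  obtain ⟨p, hp, hpj, hp'⟩ := hQ.2 j
  have hex : ∃ i, i ∈ P.activeAt (T p) ∧ i ∉ P.activeAt (T q₀) := by
    by_contra! hcon
    obtain ⟨ε, hε, hy⟩ := P.exists_pos_add_smul_mem (z := T p) (x := T.linear (p - q₀))
      (hext.subset ⟨p, hp, rfl⟩)
      (fun i hi => (eval_linear_eq_zero hext.subset hq₀ (hcon i hi) _).ge)
    rw [← map_smul, ← map_add_eq] at hy
    obtain ⟨q, hq, hqe⟩ := mem_image_of_activeAt_subset hext hq₀ hy (fun i hi => by
      have h1 := P.eval_comp_add T i q₀ (p + ε • (p - q₀) - q₀)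
      have h2 : P.eval i (T q₀) = P.rhs i := hi
      have h3 := eval_linear_eq_zero hext.subset hq₀ hi (p + ε • (p - q₀) - q₀)
      rw [add_sub_cancel, h2, sub_self, zero_add] at h1
      change _ = P.eval i _ at h1
      exact sub_eq_zero.1 (h1.trans h3))
    rw [hT hqe] at hq
    have h4 := hq j
    rw [eval_add, eval_smul, eval_sub, hpj] at h4
    nlinarith [hq₀ j]
  obtain ⟨i, hi1, hi2⟩ := hex
  refine ⟨i, hi2, Q.exists_pos_eq_mul_slack (P.eval_comp_add T i)
    (fun q hq => sub_nonneg.2 (hext.subset ⟨q, hq, rfl⟩ i)) hq₀ ?_ hpj hp' (sub_eq_zero.2 hi1)⟩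
  exact sub_pos.2 (lt_of_le_of_ne (hext.subset ⟨q₀, fun i => (hq₀ i).le, rfl⟩ i) (Ne.symm hi2))

/-- A choice of facets of `P` cutting out the facets of a face. -/
theorem exists_facet_lift_injective (hT : Function.Injective T) (hQ : Q.IsProper)
    (hext : IsExtreme ℝ P.toSet (T '' Q.toSet))
    {q₀ : Fin d' → ℝ} (hq₀ : ∀ i, Q.rhs i < Q.eval i q₀) :
    ∃ φ : Fin f' → Fin f, Function.Injective φ ∧ ∀ j, φ j ∉ P.activeAt (T q₀) ∧
      ∃ c : ℝ, 0 < c ∧ ∀ q, P.eval (φ j) (T q) - P.rhs (φ j) = c * (Q.eval j q - Q.rhs j) := by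
  choose φ hφ c hc h using exists_facet_lift hT hQ hext hq₀
  refine ⟨φ, fun j j' hjj => ?_, fun j => ⟨hφ j, c j, hc j, h j⟩⟩
  by_contra hne
  obtain ⟨p, -, hpj, hp'⟩ := hQ.2 j
  have h1 := h j p
  have h2 := h j' p
  rw [hpj, sub_self, mul_zero] at h1
  rw [← hjj, h1] at h2
  exact (mul_pos (hc j') (sub_pos.2 (hp' j' (Ne.symm hne)))).ne h2

/-- A circuit of a face along which the face is not linear is a circuit of the polyhedron. -/
theorem isCircuit_linear (hT : Function.Injective T)
    (hext : IsExtreme ℝ P.toSet (T '' Q.toSet))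
    {q₀ : Fin d' → ℝ} (hq₀ : ∀ i, Q.rhs i < Q.eval i q₀) {φ : Fin f' → Fin f}
    (hφ : ∀ j, ∃ c : ℝ, 0 < c ∧
      ∀ q, P.eval (φ j) (T q) - P.rhs (φ j) = c * (Q.eval j q - Q.rhs j))
    {g : Fin d' → ℝ} (hg : Q.IsCircuit g) {j₀ : Fin f'} (hj₀ : Q.eval j₀ g ≠ 0) :
    P.IsCircuit (T.linear g) := by
  have hTl : Function.Injective T.linear := (AffineMap.linear_injective_iff T).2 hT
  have hev : ∀ j, ∃ c : ℝ, 0 < c ∧ ∀ v, P.eval (φ j) (T.linear v) = c * Q.eval j v := by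
    intro j
    obtain ⟨c, hc, h⟩ := hφ j
    refine ⟨c, hc, fun v => ?_⟩
    have h1 := h (q₀ + v)
    have h2 := h q₀
    rw [map_add_eq, eval_add, eval_add] at h1
    linarith
  refine ⟨fun h0 => hg.1 (hTl (h0.trans (map_zero _).symm)), fun x hx hsupp => ?_⟩
  obtain ⟨v, rfl⟩ := mem_range_linear hext hq₀ (x := x) (fun i hi => by
    by_contra hne
    exact hsupp hne (eval_linear_eq_zero hext.subset hq₀ hi g))
  have hv : v ≠ 0 := fun h => hx (by rw [h, map_zero])
  have hsub : {j | Q.eval j v ≠ 0} ⊆ {j | Q.eval j g ≠ 0} := by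
    intro j hj hjg
    obtain ⟨c, hc, h⟩ := hev j
    refine hsupp (a := φ j) ?_ ?_
    · change P.eval _ _ ≠ 0
      rw [h]; exact mul_ne_zero hc.ne' hj
    · rw [h, hjg, mul_zero]
  have heq := hg.2 v hv hsub
  have hj₀v : Q.eval j₀ v ≠ 0 := by
    have : j₀ ∈ {j | Q.eval j v ≠ 0} := heq ▸ hj₀
    exact this
  have hvg : v = (Q.eval j₀ v / Q.eval j₀ g) • g := by
    by_contra hne
    have h1 := hg.2 (v - (Q.eval j₀ v / Q.eval j₀ g) • g) (sub_ne_zero.2 hne) (by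
      intro j hj hjg
      have : Q.eval j v = 0 := by
        by_contra h; exact hsub h hjg
      exact hj (by rw [eval_sub, eval_smul, this, hjg, mul_zero, sub_zero]))
    have h2 : j₀ ∈ {j | Q.eval j (v - (Q.eval j₀ v / Q.eval j₀ g) • g) ≠ 0} := h1 ▸ hj₀
    exact h2 (by rw [eval_sub, eval_smul, div_mul_cancel₀ _ hj₀, sub_self])
  have hne : Q.eval j₀ v / Q.eval j₀ g ≠ 0 := div_ne_zero hj₀v hj₀
  ext i
  change P.eval i _ ≠ 0 ↔ P.eval i _ ≠ 0
  rw [hvg, map_smul, eval_smul]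
  simp [hne]

/-- A maximal step along a circuit enters some new facet, transversally. -/
theorem exists_entered_facet (Q : PolyData d f) {y g : Fin d → ℝ} {α : ℝ} (hα : 0 < α)
    (hy' : y + α • g ∈ Q.toSet) (hmax : ∀ β : ℝ, α < β → y + β • g ∉ Q.toSet) :
    ∃ j, j ∈ Q.activeAt (y + α • g) \ Q.activeAt y ∧ Q.eval j g ≠ 0 := by
  by_contra! hcon
  obtain ⟨ε, hε, hm⟩ := Q.exists_pos_add_smul_mem (x := g) hy' (fun j hj => by
    by_cases hjy : j ∈ Q.activeAt y
    · have h1 : Q.eval j _ = _ := hj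
      have h2 : Q.eval j _ = _ := hjy
      rw [eval_add, eval_smul, h2] at h1
      have h3 : α * Q.eval j g = 0 := by linarith
      exact ((mul_eq_zero.1 h3).resolve_left hα.ne').ge
    · exact (hcon j ⟨hj, hjy⟩).ge)
  rw [add_assoc, ← add_smul] at hm
  exact hmax _ (by linarith) hm

theorem IsCSimple.of_face (hP : P.IsCSimple) (hdiam : 1 ≤ maxEdgeDiameter f' d' →
      1 ≤ maxEdgeDiameter f d) (hT : Function.Injective T) (hQ : Q.IsProper)
    (hext : IsExtreme ℝ P.toSet (T '' Q.toSet)) : Q.IsCSimple := by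
  intro k hk y hy i
  obtain ⟨q₀, hq₀⟩ := hQ.1
  obtain ⟨φ, hφinj, hφ⟩ := exists_facet_lift_injective hT hQ hext hq₀
  have h1 : 1 ≤ maxEdgeDiameter f d := hdiam (le_trans (by
    have : 1 ≤ k := Nat.one_le_iff_ne_zero.2 (by rintro rfl; exact i.elim0)
    exact_mod_cast this) hk)
  obtain ⟨hmem, hstep⟩ := hy
  obtain ⟨g, hg, α, hα, hyg, hmax⟩ := hstep i
  have hm := hmem i.succ
  rw [hyg] at hm
  obtain ⟨j₀, hj₀, hj₀g⟩ := Q.exists_entered_facet hα hm hmax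
  rw [← hyg] at hj₀
  have hcirc := isCircuit_linear hT hext hq₀ (fun j => (hφ j).2) hg hj₀g
  have hTs : ∀ β : ℝ, T (y i.castSucc + β • g) = T (y i.castSucc) + β • T.linear g := by
    intro β; rw [map_add_eq, map_smul]
  have hwalk : P.IsCircuitWalk (k := 1) ![T (y i.castSucc), T (y i.succ)] := by
    refine ⟨fun a => ?_, fun a => ?_⟩
    · fin_cases a
      · exact hext.subset ⟨_, hmem _, rfl⟩
      · exact hext.subset ⟨_, hmem _, rfl⟩
    · fin_cases a
      refine ⟨T.linear g, hcirc, α, hα, ?_, fun β hβ hin => ?_⟩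
      · change T (y i.succ) = T (y i.castSucc) + _
        rw [hyg, hTs]
      · change T (y i.castSucc) + _ ∈ _ at hin
        have hin' := mem_image_of_activeAt_subset hext hq₀ hin (fun a ha => by
          have h2 := P.eval_comp_add T a q₀ (y i.castSucc + β • g - q₀)
          have h3 : P.eval a (T q₀) = P.rhs a := ha
          have h4 := eval_linear_eq_zero hext.subset hq₀ ha (y i.castSucc + β • g - q₀)
          rw [add_sub_cancel, h3, sub_self, zero_add, hTs] at h2
          change _ = P.eval a _ at h2
          exact sub_eq_zero.1 (h2.trans h4))
        rw [← hTs] at hin'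
        obtain ⟨q, hq, hqe⟩ := hin'
        rw [hT hqe] at hq
        exact hmax β hβ hq
  have hcard : (P.activeAt (T (y i.succ)) \ P.activeAt (T (y i.castSucc))).ncard = 1 :=
    hP 1 (by exact_mod_cast h1) _ hwalk 0
  have hact : ∀ j q, φ j ∈ P.activeAt (T q) ↔ j ∈ Q.activeAt q := by
    intro j q
    obtain ⟨-, c, hc, h⟩ := hφ j
    change P.eval (φ j) (T q) = P.rhs (φ j) ↔ Q.eval j q = Q.rhs j
    rw [← sub_eq_zero, h q, mul_eq_zero, or_iff_right hc.ne', sub_eq_zero]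
  refine le_antisymm ?_ ?_
  · rw [← hcard, ← Set.ncard_image_of_injective _ hφinj]
    refine Set.ncard_le_ncard ?_
    rintro _ ⟨j, hj, rfl⟩
    exact ⟨(hact _ _).2 hj.1, fun h => hj.2 ((hact _ _).1 h)⟩
  · exact Nat.one_le_iff_ne_zero.2 (Set.ncard_ne_zero_of_mem hj₀)

end Realization

end PolyData

namespace PolyData

variable {d f d' f' : ℕ}

theorem le_facets_of_one_le_maxEdgeDiameter (h : 1 ≤ maxEdgeDiameter f d) : d + 1 ≤ f := by
  by_contra! hf
  have hfd : f ≤ d := by omega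
  have h0 : maxEdgeDiameter f d ≤ 0 := by
    refine iSup₂_le fun P _ => iSup₂_le fun u v => iSup₂_le fun hu hv => ?_
    have huniv : ∀ w, P.IsVertex w → P.activeAt w = Set.univ := by
      intro w hw
      have h1 : d ≤ (P.activeAt w).ncard := by
        classical
        have h2 := finrank_span_le_card (R := ℝ) (P.row '' P.activeAt w)
        rw [hw.2, finrank_top, Module.finrank_fin_fun, ← Set.ncard_eq_toFinset_card'] at h2
        exact h2.trans (Set.ncard_image_le (Set.toFinite _))
      refine Set.eq_of_subset_of_ncard_le (Set.subset_univ _) ?_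
      rw [Set.ncard_univ, Nat.card_fin]
      omega
    have huv : u = v := by
      have hz : ∀ r ∈ Submodule.span ℝ (P.row '' P.activeAt u), r ⬝ᵥ (u - v) = 0 := by
        intro r hr
        induction hr using Submodule.span_induction with
        | mem r hr =>
          obtain ⟨i, hi, rfl⟩ := hr
          have h1 : P.eval i u = P.rhs i := hi
          have h2 : P.eval i v = P.rhs i := by
            have : i ∈ P.activeAt v := huniv v hv ▸ Set.mem_univ i
            exact this
          have h3 := P.eval_sub i u v
          rw [h1, h2, sub_self] at h3
          exact h3
        | zero => simp
        | add x y _ _ hx hy => rw [add_dotProduct, hx, hy, add_zero]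
        | smul c x _ hx => rw [smul_dotProduct, hx, smul_zero]
      rw [hu.2] at hz
      exact sub_eq_zero.1 (dotProduct_self_eq_zero.1 (hz _ Submodule.mem_top))
    subst huv
    exact sInf_le ⟨0, rfl, fun _ => u, fun i => i.elim0, rfl, rfl⟩
  exact absurd (h.trans h0) (by simp)

theorem one_le_maxEdgeDiameter_of_vertices {P : PolyData d f} (hP : P.IsProper)
    {u v : Fin d → ℝ} (hu : P.IsVertex u) (hv : P.IsVertex v) (huv : u ≠ v) :
    1 ≤ maxEdgeDiameter f d := by
  refine le_trans ?_ (le_iSup₂_of_le P hP (le_iSup₂_of_le u v (le_iSup₂_of_le hu hv le_rfl)))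
  refine le_sInf ?_
  rintro _ ⟨k, rfl, y, -, h0, hlast⟩
  have hk : k ≠ 0 := by
    rintro rfl
    exact huv (h0.symm.trans hlast)
  exact_mod_cast Nat.one_le_iff_ne_zero.2 hk

/-- The product of an unbounded polygon with `n` edges, tangent to a parabola, and the orthant
of dimension `m`. -/
def tangentPolygonProd (m n : ℕ) : PolyData (m + 2) (m + n) where
  A := Fin.append (fun i => Fin.append (Pi.single i 1) 0)
    (fun i => Fin.append 0 ![-2 * (i : ℚ), 1])
  b := Fin.append 0 (fun i => -(i : ℚ) ^ 2)

theorem tangentPolygonProd_row_left (m n : ℕ) (i : Fin m) :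
    (tangentPolygonProd m n).row (Fin.castAdd n i) = Pi.single (Fin.castAdd 2 i) 1 := by
  ext k
  refine Fin.addCases (fun k => ?_) (fun k => ?_) k
  · by_cases h : k = i <;> simp [row, tangentPolygonProd, h]
  · have h : Fin.natAdd m k ≠ Fin.castAdd 2 i := fun h => by
      have := congrArg Fin.val h
      simp only [Fin.val_natAdd, Fin.val_castAdd] at this
      omega
    simp [row, tangentPolygonProd, h]

theorem tangentPolygonProd_row_right (m n : ℕ) (i : Fin n) :
    (tangentPolygonProd m n).row (Fin.natAdd m i) =
      Fin.append (0 : Fin m → ℝ) ![-2 * (i : ℝ), 1] := by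
  ext k
  refine Fin.addCases (fun k => ?_) (fun k => ?_) k
  · simp [row, tangentPolygonProd]
  · fin_cases k <;> simp [row, tangentPolygonProd, -Fin.natAdd_eq_addNat]

theorem tangentPolygonProd_eval_left (m n : ℕ) (i : Fin m) (z : Fin (m + 2) → ℝ) :
    (tangentPolygonProd m n).eval (Fin.castAdd n i) z = z (Fin.castAdd 2 i) := by
  rw [eval, tangentPolygonProd_row_left]
  exact single_one_dotProduct _ z

theorem tangentPolygonProd_eval_right (m n : ℕ) (i : Fin n) (z : Fin (m + 2) → ℝ) :
    (tangentPolygonProd m n).eval (Fin.natAdd m i) z =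
      -2 * (i : ℝ) * z (Fin.natAdd m 0) + z (Fin.natAdd m 1) := by
  rw [eval, tangentPolygonProd_row_right]
  simp [Fin.sum_univ_add]

theorem tangentPolygonProd_rhs_left (m n : ℕ) (i : Fin m) :
    (tangentPolygonProd m n).rhs (Fin.castAdd n i) = 0 := by
  simp [rhs, tangentPolygonProd]

theorem tangentPolygonProd_rhs_right (m n : ℕ) (i : Fin n) :
    (tangentPolygonProd m n).rhs (Fin.natAdd m i) = -(i : ℝ) ^ 2 := by
  simp [rhs, tangentPolygonProd]

theorem tangentPolygonProd_isProper (m n : ℕ) : (tangentPolygonProd m n).IsProper := by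
  refine ⟨⟨Fin.append 1 ![0, 1], fun i => ?_⟩, fun i => ?_⟩
  · refine Fin.addCases (fun i => ?_) (fun i => ?_) i
    · simp [tangentPolygonProd_eval_left, tangentPolygonProd_rhs_left]
    · simp only [tangentPolygonProd_eval_right, tangentPolygonProd_rhs_right, Fin.append_right]
      simp
      nlinarith [sq_nonneg (i : ℝ)]
  · suffices h : ∃ z, (tangentPolygonProd m n).eval i z = (tangentPolygonProd m n).rhs i ∧
        ∀ i', i' ≠ i → (tangentPolygonProd m n).rhs i' < (tangentPolygonProd m n).eval i' z by
      obtain ⟨z, h1, h2⟩ := h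
      refine ⟨z, fun i' => ?_, h1, h2⟩
      by_cases hi : i' = i
      · subst hi; exact h1.ge
      · exact (h2 i' hi).le
    refine Fin.addCases (fun i => ?_) (fun i => ?_) i
    · refine ⟨Fin.append (fun k => if k = i then 0 else 1) ![0, 1], ?_, fun i' => ?_⟩
      · simp [tangentPolygonProd_eval_left, tangentPolygonProd_rhs_left]
      · refine Fin.addCases (fun i' hi' => ?_) (fun i' _ => ?_) i'
        · have : i' ≠ i := fun h => hi' (by rw [h])
          simp [tangentPolygonProd_eval_left, tangentPolygonProd_rhs_left, this]
        · simp only [tangentPolygonProd_eval_right, tangentPolygonProd_rhs_right,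
            Fin.append_right]
          simp
          nlinarith [sq_nonneg (i' : ℝ)]
    · refine ⟨Fin.append 1 ![(i : ℝ), (i : ℝ) ^ 2], ?_, fun i' => ?_⟩
      · simp only [tangentPolygonProd_eval_right, tangentPolygonProd_rhs_right,
          Fin.append_right]
        simp
        ring
      · refine Fin.addCases (fun i' _ => ?_) (fun i' hi' => ?_) i'
        · simp [tangentPolygonProd_eval_left, tangentPolygonProd_rhs_left]
        · have hne : (i : ℝ) - (i' : ℝ) ≠ 0 := by
            refine sub_ne_zero.2 fun h => hi' ?_
            rw [Fin.ext (by exact_mod_cast h : (i : ℕ) = i')]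
          have := sq_pos_of_ne_zero hne
          simp only [tangentPolygonProd_eval_right, tangentPolygonProd_rhs_right,
            Fin.append_right]
          simp
          nlinarith

theorem single_natAdd_zero (m : ℕ) :
    (Pi.single (Fin.natAdd m 0) 1 : Fin (m + 2) → ℝ) = Fin.append (0 : Fin m → ℝ) ![1, 0] := by
  ext k
  refine Fin.addCases (fun k => ?_) (fun k => ?_) k
  · simp [Fin.ext_iff, k.2.ne]
  · fin_cases k <;> simp [Fin.ext_iff, -Fin.natAdd_eq_addNat]

theorem single_natAdd_one (m : ℕ) :
    (Pi.single (Fin.natAdd m 1) 1 : Fin (m + 2) → ℝ) = Fin.append (0 : Fin m → ℝ) ![0, 1] := by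
  ext k
  refine Fin.addCases (fun k => ?_) (fun k => ?_) k
  · have : (k : ℕ) ≠ m + 1 := by omega
    simp [Fin.ext_iff, this]
  · fin_cases k <;> simp [Fin.ext_iff, -Fin.natAdd_eq_addNat]

theorem tangentPolygonProd_isVertex (m n : ℕ) (i : ℕ) (hi : i + 1 < n) :
    (tangentPolygonProd m n).IsVertex
      (Fin.append 0 ![(i : ℝ) + 1 / 2, (i : ℝ) ^ 2 + i]) := by
  set P := tangentPolygonProd m n
  set w : Fin (m + 2) → ℝ := Fin.append 0 ![(i : ℝ) + 1 / 2, (i : ℝ) ^ 2 + i]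
  have hleft : ∀ a : Fin m, Fin.castAdd n a ∈ P.activeAt w := fun a => by
    change P.eval _ _ = P.rhs _
    simp [P, w, tangentPolygonProd_eval_left, tangentPolygonProd_rhs_left]
  have hslack : ∀ a : Fin n, P.eval (Fin.natAdd m a) w - P.rhs (Fin.natAdd m a) =
      ((a : ℝ) - i) * ((a : ℝ) - (i + 1)) := fun a => by
    simp only [P, w, tangentPolygonProd_eval_right, tangentPolygonProd_rhs_right,
      Fin.append_right]
    simp
    ring
  have h1 : Fin.natAdd m ⟨i, by omega⟩ ∈ P.activeAt w := by
    refine sub_eq_zero.1 ?_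
    rw [hslack]; simp
  have h2 : Fin.natAdd m ⟨i + 1, hi⟩ ∈ P.activeAt w := by
    refine sub_eq_zero.1 ?_
    rw [hslack]; simp
  refine ⟨fun a => ?_, ?_⟩
  · refine Fin.addCases (fun a => (hleft a).ge) (fun a => sub_nonneg.1 ?_) a
    rw [hslack]
    rcases le_or_gt (a : ℕ) i with h | h
    · have : (a : ℝ) ≤ i := by exact_mod_cast h
      nlinarith
    · have : (i : ℝ) + 1 ≤ a := by exact_mod_cast h
      nlinarith
  · have hmem : ∀ a ∈ P.activeAt w, P.row a ∈ Submodule.span ℝ (P.row '' P.activeAt w) :=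
      fun a ha => Submodule.subset_span ⟨a, ha, rfl⟩
    have e1 : (Pi.single (Fin.natAdd m 0) 1 : Fin (m + 2) → ℝ) =
        (1 / 2 : ℝ) • (P.row (Fin.natAdd m ⟨i, by omega⟩) -
          P.row (Fin.natAdd m ⟨i + 1, hi⟩)) := by
      rw [tangentPolygonProd_row_right, tangentPolygonProd_row_right, single_natAdd_zero]
      ext k
      refine Fin.addCases (fun k => ?_) (fun k => ?_) k
      · simp
      · fin_cases k <;> simp [-Fin.natAdd_eq_addNat]
        ring
    have e2 : (Pi.single (Fin.natAdd m 1) 1 : Fin (m + 2) → ℝ) =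
        P.row (Fin.natAdd m ⟨i, by omega⟩) +
          (2 * i : ℝ) • (Pi.single (Fin.natAdd m 0) 1 : Fin (m + 2) → ℝ) := by
      rw [tangentPolygonProd_row_right, single_natAdd_zero, single_natAdd_one]
      ext k
      refine Fin.addCases (fun k => ?_) (fun k => ?_) k
      · simp
      · fin_cases k <;> simp [-Fin.natAdd_eq_addNat]
    have m1 : (Pi.single (Fin.natAdd m 0) 1 : Fin (m + 2) → ℝ) ∈
        Submodule.span ℝ (P.row '' P.activeAt w) := by
      rw [e1]
      exact Submodule.smul_mem _ _ (Submodule.sub_mem _ (hmem _ h1) (hmem _ h2))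
    have m2 : (Pi.single (Fin.natAdd m 1) 1 : Fin (m + 2) → ℝ) ∈
        Submodule.span ℝ (P.row '' P.activeAt w) := by
      rw [e2]
      exact Submodule.add_mem _ (hmem _ h1) (Submodule.smul_mem _ _ m1)
    rw [eq_top_iff, ← (Pi.basisFun ℝ (Fin (m + 2))).span_eq, Submodule.span_le]
    rintro _ ⟨k, rfl⟩
    rw [Pi.basisFun_apply]
    refine Fin.addCases (fun k => ?_) (fun k => ?_) k
    · rw [← tangentPolygonProd_row_left m n]
      exact hmem _ (hleft k)
    · fin_cases k
      · exact m1
      · exact m2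

theorem one_le_maxEdgeDiameter (hd : 2 ≤ d) (hf : d + 1 ≤ f) : 1 ≤ maxEdgeDiameter f d := by
  obtain ⟨m, rfl⟩ := Nat.exists_eq_add_of_le' hd
  obtain ⟨n, rfl⟩ := Nat.exists_eq_add_of_le (show m + 3 ≤ f by omega)
  rw [add_assoc]
  refine one_le_maxEdgeDiameter_of_vertices (tangentPolygonProd_isProper m (3 + n))
    (tangentPolygonProd_isVertex m (3 + n) 0 (by omega))
    (tangentPolygonProd_isVertex m (3 + n) 1 (by omega)) fun h => ?_
  have := congrFun h (Fin.natAdd m 1)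
  norm_num at this

theorem facets_add_dim_le {P : PolyData d f} {Q : PolyData d' f'}
    {T : (Fin d' → ℝ) →ᵃ[ℝ] (Fin d → ℝ)} (hT : Function.Injective T) (hQ : Q.IsProper)
    (hext : IsExtreme ℝ P.toSet (T '' Q.toSet)) : f' + d ≤ f + d' := by
  obtain ⟨q₀, hq₀⟩ := hQ.1
  obtain ⟨φ, hφinj, hφ⟩ := exists_facet_lift_injective hT hQ hext hq₀
  have h1 : f' ≤ (P.activeAt (T q₀))ᶜ.ncard := by
    have h2 : (Set.range φ).ncard = f' := by
      rw [← Set.image_univ, Set.ncard_image_of_injective _ hφinj, Set.ncard_univ, Nat.card_fin]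
    rw [← h2]
    refine Set.ncard_le_ncard ?_
    rintro _ ⟨j, rfl⟩
    exact (hφ j).1
  let L : (Fin d → ℝ) →ₗ[ℝ] (P.activeAt (T q₀) → ℝ) := LinearMap.pi fun i => P.evalLin i
  have h2 := L.finrank_range_add_finrank_ker
  have h3 : Module.finrank ℝ L.range ≤ (P.activeAt (T q₀)).ncard := by
    classical
    refine (Submodule.finrank_le _).trans ?_
    rw [Module.finrank_fintype_fun_eq_card, ← Nat.card_eq_fintype_card]
    rfl
  have h4 : Module.finrank ℝ L.ker ≤ d' := by
    refine (Submodule.finrank_mono (t := T.linear.range) fun x hx => ?_).trans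
      (T.linear.finrank_range_le.trans (by simp))
    obtain ⟨v, hv⟩ := mem_range_linear hext hq₀ (x := x) (fun i hi => congrFun hx ⟨i, hi⟩)
    exact ⟨v, hv⟩
  have h5 := Set.ncard_add_ncard_compl (P.activeAt (T q₀))
  rw [Nat.card_fin] at h5
  rw [Module.finrank_fin_fun] at h2
  omega

/-- The wedge over the facet `j` bounded by the slack of that facet. -/
def slackWedge (Q : PolyData d f) (j : Fin f) : PolyData (d + 1) (f + 1) where
  A := Fin.snoc (α := fun _ => Fin (d + 1) → ℚ)
    (fun i => Fin.snoc (α := fun _ => ℚ) (Q.A i) (if i = j then -1 else 0))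
    (Fin.snoc (α := fun _ => ℚ) 0 1)
  b := Fin.snoc (α := fun _ => ℚ) Q.b 0

theorem slackWedge_eval_castSucc (Q : PolyData d f) (j i : Fin f) (z : Fin d → ℝ) (t : ℝ) :
    (Q.slackWedge j).eval i.castSucc (snocVec z t) = Q.eval i z - if i = j then t else 0 := by
  simp only [eval, row, slackWedge, snocVec, Fin.sum_univ_castSucc, Fin.snoc_castSucc,
    Fin.snoc_last]
  split_ifs <;> simp [sub_eq_add_neg]

theorem slackWedge_eval_last (Q : PolyData d f) (j : Fin f) (z : Fin d → ℝ) (t : ℝ) :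
    (Q.slackWedge j).eval (Fin.last f) (snocVec z t) = t := by
  simp [eval, row, slackWedge, snocVec, Fin.sum_univ_castSucc]

theorem slackWedge_rhs_castSucc (Q : PolyData d f) (j i : Fin f) :
    (Q.slackWedge j).rhs i.castSucc = Q.rhs i := by
  simp [rhs, slackWedge]

theorem slackWedge_rhs_last (Q : PolyData d f) (j : Fin f) :
    (Q.slackWedge j).rhs (Fin.last f) = 0 := by
  simp [rhs, slackWedge]

theorem mem_slackWedge_iff (Q : PolyData d f) (j : Fin f) (z : Fin d → ℝ) (t : ℝ) :
    snocVec z t ∈ (Q.slackWedge j).toSet ↔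
      z ∈ Q.toSet ∧ 0 ≤ t ∧ t ≤ Q.eval j z - Q.rhs j := by
  constructor
  · intro h
    have ht := h (Fin.last f)
    rw [slackWedge_eval_last, slackWedge_rhs_last] at ht
    have hc : ∀ i, Q.rhs i ≤ Q.eval i z - if i = j then t else 0 := fun i => by
      have := h i.castSucc
      rwa [slackWedge_eval_castSucc, slackWedge_rhs_castSucc] at this
    refine ⟨fun i => (hc i).trans ?_, ht, ?_⟩
    · split_ifs <;> linarith
    · have := hc j
      rw [if_pos rfl] at this
      linarith
  · rintro ⟨hz, ht, hj⟩ i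
    refine Fin.lastCases ?_ (fun i => ?_) i
    · rwa [slackWedge_eval_last, slackWedge_rhs_last]
    · rw [slackWedge_eval_castSucc, slackWedge_rhs_castSucc]
      split_ifs with h
      · subst h; linarith
      · have := hz i
        linarith

theorem slackWedge_isProper {Q : PolyData d f} (hQ : Q.IsProper) (j : Fin f) :
    (Q.slackWedge j).IsProper := by
  obtain ⟨⟨q₀, hq₀⟩, hfacet⟩ := hQ
  have hj := hq₀ j
  refine ⟨⟨snocVec q₀ ((Q.eval j q₀ - Q.rhs j) / 2), fun i => ?_⟩, fun i => ?_⟩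
  · refine Fin.lastCases ?_ (fun i => ?_) i
    · rw [slackWedge_eval_last, slackWedge_rhs_last]
      linarith
    · rw [slackWedge_eval_castSucc, slackWedge_rhs_castSucc]
      split_ifs with h
      · subst h; linarith
      · linarith [hq₀ i]
  · refine Fin.lastCases ?_ (fun i => ?_) i
    · refine ⟨snocVec q₀ 0, ?_, ?_, fun i' => ?_⟩
      · rw [mem_slackWedge_iff]
        exact ⟨fun i => (hq₀ i).le, le_rfl, by linarith⟩
      · rw [slackWedge_eval_last, slackWedge_rhs_last]
      · refine Fin.lastCases (fun h => absurd rfl h) (fun i' _ => ?_) i'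
        rw [slackWedge_eval_castSucc, slackWedge_rhs_castSucc]
        simpa using hq₀ i'
    · by_cases hij : i = j
      · subst hij
        refine ⟨snocVec q₀ (Q.eval i q₀ - Q.rhs i), ?_, ?_, fun i' => ?_⟩
        · rw [mem_slackWedge_iff]
          exact ⟨fun i => (hq₀ i).le, by linarith, le_rfl⟩
        · rw [slackWedge_eval_castSucc, slackWedge_rhs_castSucc, if_pos rfl, sub_sub_cancel]
        · refine Fin.lastCases (fun _ => ?_) (fun i' hi' => ?_) i'
          · rw [slackWedge_eval_last, slackWedge_rhs_last]
            linarith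
          · have : i' ≠ i := fun h => hi' (by rw [h])
            rw [slackWedge_eval_castSucc, slackWedge_rhs_castSucc, if_neg this, sub_zero]
            exact hq₀ i'
      · obtain ⟨p, hp, hpi, hp'⟩ := hfacet i
        have hpj := hp' j (Ne.symm hij)
        refine ⟨snocVec p ((Q.eval j p - Q.rhs j) / 2), ?_, ?_, fun i' => ?_⟩
        · rw [mem_slackWedge_iff]
          exact ⟨hp, by linarith, by linarith⟩
        · rw [slackWedge_eval_castSucc, slackWedge_rhs_castSucc, if_neg hij, sub_zero, hpi]
        · refine Fin.lastCases (fun _ => ?_) (fun i' hi' => ?_) i'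
          · rw [slackWedge_eval_last, slackWedge_rhs_last]
            linarith
          · have : i' ≠ i := fun h => hi' (by rw [h])
            have := hp' i' this
            rw [slackWedge_eval_castSucc, slackWedge_rhs_castSucc]
            split_ifs with h
            · subst h; linarith
            · linarith

theorem exists_eq_snocVec (w : Fin (d + 1) → ℝ) : ∃ z t, w = snocVec z t :=
  ⟨Fin.init w, w (Fin.last d), (Fin.snoc_init_self w).symm⟩

theorem sum_mul_snocVec (a : Fin (d + 1) → ℝ) (z : Fin d → ℝ) (t : ℝ) :
    ∑ j, a j * snocVec z t j = (∑ j : Fin d, a j.castSucc * z j) + a (Fin.last d) * t := by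
  simp [snocVec, Fin.sum_univ_castSucc]

theorem slackWedge_isWedgeOver {Q : PolyData d f} (hQ : Q.IsProper) (j : Fin f) :
    (Q.slackWedge j).IsWedgeOver Q j := by
  obtain ⟨q₀, hq₀⟩ := hQ.1
  have hsum : ∀ z t, ∑ k, (snocVec (-Q.row j) 1 : Fin (d + 1) → ℝ) k * snocVec z t k =
      t - Q.eval j z := by
    intro z t
    rw [sum_mul_snocVec]
    simp [snocVec, eval]
    ring
  refine ⟨snocVec (-Q.row j) 1, -Q.rhs j, fun z hz => ?_,
    ⟨q₀, hq₀, Q.eval j q₀ - Q.rhs j, sub_pos.2 (hq₀ j), ?_⟩, fun z hz => ?_, ?_⟩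
  · rw [hsum]
    linarith [hz j]
  · rw [hsum]
    ring
  · rw [hsum, zero_sub, neg_inj]
    exact ⟨fun h => ⟨hz, h⟩, fun h => h.2⟩
  · ext w
    obtain ⟨z, t, rfl⟩ := exists_eq_snocVec w
    rw [mem_slackWedge_iff]
    constructor
    · rintro ⟨hz, ht, hle⟩
      refine ⟨?_, z, hz, t, ht, rfl⟩
      refine (hsum z t).trans_le ?_
      linarith
    · rintro ⟨hle, z', hz', t', ht', he⟩
      obtain ⟨rfl, rfl⟩ := Fin.snoc_injective2 he
      replace hle := (hsum z t).symm.trans_le hle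
      exact ⟨hz', ht', by linarith⟩

/-- The affine map `(q, t) ↦ (T q, s * t)`. -/
noncomputable def liftSnoc (T : (Fin d' → ℝ) →ᵃ[ℝ] (Fin d → ℝ)) (s : ℝ) :
    (Fin (d' + 1) → ℝ) →ᵃ[ℝ] (Fin (d + 1) → ℝ) :=
  AffineMap.pi (Fin.snoc (α := fun _ => (Fin (d' + 1) → ℝ) →ᵃ[ℝ] ℝ)
    (fun i => ((AffineMap.proj i).comp T).comp
      (LinearMap.funLeft ℝ ℝ Fin.castSucc).toAffineMap)
    (s • (LinearMap.proj (R := ℝ) (φ := fun _ => ℝ) (Fin.last d')).toAffineMap))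

theorem liftSnoc_apply (T : (Fin d' → ℝ) →ᵃ[ℝ] (Fin d → ℝ)) (s : ℝ) (q : Fin d' → ℝ) (t : ℝ) :
    liftSnoc T s (snocVec q t) = snocVec (T q) (s * t) := by
  have hq : (fun i : Fin d' => snocVec q t i.castSucc) = q := by
    funext i; simp [snocVec]
  ext k
  refine Fin.lastCases ?_ (fun k => ?_) k
  · simp [liftSnoc, snocVec]
  · have : LinearMap.funLeft ℝ ℝ Fin.castSucc (snocVec q t) = q := hq
    simp [liftSnoc, this]
    simp [snocVec]

/-- A wedge on `P` contains, as an extreme subset, a wedge on every face of `P`. -/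
theorem exists_realization_slackWedge {P : PolyData d f} {Q : PolyData d' f'}
    {T : (Fin d' → ℝ) →ᵃ[ℝ] (Fin d → ℝ)} (hT : Function.Injective T) (hQ : Q.IsProper)
    (hext : IsExtreme ℝ P.toSet (T '' Q.toSet)) {i : Fin f} {j : Fin f'}
    (hij : ∃ c : ℝ, 0 < c ∧ ∀ q, P.eval i (T q) - P.rhs i = c * (Q.eval j q - Q.rhs j))
    {W : PolyData (d + 1) (f + 1)} (hW : W.IsWedgeOver P i) :
    ∃ T' : (Fin (d' + 1) → ℝ) →ᵃ[ℝ] (Fin (d + 1) → ℝ), Function.Injective T' ∧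
      IsExtreme ℝ W.toSet (T' '' (Q.slackWedge j).toSet) := by
  obtain ⟨a, β, hle, ⟨z₁, hz₁, t₁, ht₁, hzt₁⟩, hiff, hWset⟩ := hW
  obtain ⟨q₀, hq₀⟩ := hQ.1
  obtain ⟨c, hc, hcq⟩ := hij
  simp only [sum_mul_snocVec, mul_zero, add_zero] at hle hzt₁ hiff
  set γ := a (Fin.last d)
  let ℓ : (Fin d → ℝ) →ₗ[ℝ] ℝ := dotProductBilin ℝ ℝ (fun j : Fin d => a j.castSucc)
  have hℓ : ∀ z, ∑ j : Fin d, a j.castSucc * z j = ℓ z := fun z => rfl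
  simp only [hℓ] at hle hzt₁ hiff
  have hγpos : 0 < γ := by
    have hz₁m : z₁ ∈ P.toSet := fun i => (hz₁ i).le
    have h1 : ℓ z₁ ≠ β := fun h => (hz₁ i).ne' ((hiff z₁ hz₁m).1 h).2
    have h2 := lt_of_le_of_ne (hle z₁ hz₁m) h1
    have h3 : 0 < γ * t₁ := by linarith
    exact pos_of_mul_pos_left h3 ht₁.le
  have hactive : ∀ q ∈ Q.toSet, β - ℓ (T q) = 0 ↔ Q.eval j q = Q.rhs j := by
    intro q hq
    have hTq := hext.subset ⟨q, hq, rfl⟩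
    rw [sub_eq_zero, eq_comm, hiff _ hTq]
    have h1 := hcq q
    constructor
    · intro h
      rw [h.2, sub_self, eq_comm, mul_eq_zero, or_iff_right hc.ne'] at h1
      exact sub_eq_zero.1 h1
    · intro h
      rw [h, sub_self, mul_zero] at h1
      exact ⟨hTq, sub_eq_zero.1 h1⟩
  have hq₀m : q₀ ∈ Q.toSet := fun i => (hq₀ i).le
  obtain ⟨p, hp, hpj, hp'⟩ := hQ.2 j
  obtain ⟨e, he, heq⟩ := Q.exists_pos_eq_mul_slack (h := fun q => β - ℓ (T q))
    (l := -(ℓ.comp T.linear))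
    (fun q v => by
      simp only [map_add_eq, map_add, LinearMap.neg_apply, LinearMap.comp_apply]
      ring)
    (fun q hq => sub_nonneg.2 (hle _ (hext.subset ⟨q, hq, rfl⟩))) hq₀
    (lt_of_le_of_ne (sub_nonneg.2 (hle _ (hext.subset ⟨q₀, hq₀m, rfl⟩)))
      (fun h => (hq₀ j).ne' ((hactive q₀ hq₀m).1 h.symm)))
    hpj hp' ((hactive p hp).2 hpj)
  have hWmem : ∀ z t, snocVec z t ∈ W.toSet ↔ z ∈ P.toSet ∧ 0 ≤ t ∧ γ * t ≤ β - ℓ z := by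
    intro z t
    rw [hWset]
    constructor
    · rintro ⟨h1, z', hz', t', ht', h2⟩
      obtain ⟨rfl, rfl⟩ := Fin.snoc_injective2 h2
      replace h1 := (sum_mul_snocVec a z t).symm.trans_le h1
      rw [hℓ] at h1
      exact ⟨hz', ht', by linarith⟩
    · rintro ⟨hz, ht, h1⟩
      refine ⟨?_, z, hz, t, ht, rfl⟩
      refine (sum_mul_snocVec a z t).trans_le ?_
      rw [hℓ]
      linarith
  have hpos : 0 < e / γ := div_pos he hγpos
  have himage : ∀ z t, snocVec z t ∈ liftSnoc T (e / γ) '' (Q.slackWedge j).toSet ↔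
      snocVec z t ∈ W.toSet ∧ z ∈ T '' Q.toSet := by
    intro z t
    constructor
    · rintro ⟨w, hw, h⟩
      obtain ⟨q, s, rfl⟩ := exists_eq_snocVec w
      rw [liftSnoc_apply] at h
      obtain ⟨rfl, rfl⟩ := Fin.snoc_injective2 h
      obtain ⟨hq, hs, hsj⟩ := (mem_slackWedge_iff _ _ _ _).1 hw
      have hqe := heq q
      refine ⟨(hWmem _ _).2 ⟨hext.subset ⟨q, hq, rfl⟩, by positivity, ?_⟩, q, hq, rfl⟩
      rw [hqe, ← mul_assoc, mul_div_cancel₀ _ hγpos.ne']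
      exact mul_le_mul_of_nonneg_left hsj he.le
    · rintro ⟨hw, q, hq, rfl⟩
      obtain ⟨-, ht, hle'⟩ := (hWmem _ _).1 hw
      have hqe := heq q
      refine ⟨snocVec q (γ / e * t), (mem_slackWedge_iff _ _ _ _).2 ⟨hq, by positivity, ?_⟩, ?_⟩
      · rw [hqe] at hle'
        rw [div_mul_eq_mul_div, div_le_iff₀ he]
        linarith
      · rw [liftSnoc_apply]
        congr 1
        field_simp
  refine ⟨liftSnoc T (e / γ), fun w w' h => ?_, fun w hw => ?_, fun x hx y hy w hw hxy => ?_⟩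
  · obtain ⟨q, t, rfl⟩ := exists_eq_snocVec w
    obtain ⟨q', t', rfl⟩ := exists_eq_snocVec w'
    rw [liftSnoc_apply, liftSnoc_apply] at h
    obtain ⟨h1, h2⟩ := Fin.snoc_injective2 h
    rw [hT h1, mul_left_cancel₀ hpos.ne' h2]
  · obtain ⟨z, t, rfl⟩ := exists_eq_snocVec w
    exact ((himage z t).1 hw).1
  · obtain ⟨zx, tx, rfl⟩ := exists_eq_snocVec x
    obtain ⟨zy, ty, rfl⟩ := exists_eq_snocVec y
    obtain ⟨z, t, rfl⟩ := exists_eq_snocVec w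
    refine (himage _ _).2 ⟨hx, hext.left_mem_of_mem_openSegment ((hWmem _ _).1 hx).1
      ((hWmem _ _).1 hy).1 ((himage _ _).1 hw).2 ?_⟩
    obtain ⟨r, s, hr, hs, hrs, h⟩ := hxy
    refine ⟨r, s, hr, hs, hrs, ?_⟩
    ext k
    have := congrFun h k.castSucc
    simpa [snocVec] using this

end PolyData

open PolyData in
theorem IsKWedgeSimpleAux.of_face (k : ℕ) : ∀ {d f d' f' : ℕ} (P : PolyData d f)
    (_ : IsKWedgeSimpleAux k d f P) (_ : d' < d) (_ : 1 < d')
    (Q : PolyData d' f') (_ : Q.IsProper) (T : (Fin d' → ℝ) →ᵃ[ℝ] (Fin d → ℝ))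
    (_ : Function.Injective T) (_ : IsExtreme ℝ P.toSet (T '' Q.toSet)),
    IsKWedgeSimpleAux k d' f' Q := by
  have hC : ∀ {d f d' f' : ℕ} {P : PolyData d f} (_ : P.IsCSimple) (_ : d' < d) (_ : 1 < d')
      {Q : PolyData d' f'} (_ : Q.IsProper) {T : (Fin d' → ℝ) →ᵃ[ℝ] (Fin d → ℝ)}
      (_ : Function.Injective T) (_ : IsExtreme ℝ P.toSet (T '' Q.toSet)), Q.IsCSimple := by
    intro d f d' f' P hP hd hd' Q hQ T hT hext
    refine hP.of_face (fun h => one_le_maxEdgeDiameter (by omega) ?_) hT hQ hext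
    have h1 := le_facets_of_one_le_maxEdgeDiameter h
    have h2 := facets_add_dim_le hT hQ hext
    omega
  induction k with
  | zero =>
    intro d f d' f' P hP hd hd' Q hQ T hT hext
    exact hC hP hd hd' hQ hT hext
  | succ k ih =>
    intro d f d' f' P hP hd hd' Q hQ T hT hext
    refine ⟨hC hP.1 hd hd' hQ hT hext, fun j => ?_⟩
    obtain ⟨q₀, hq₀⟩ := hQ.1
    obtain ⟨i, -, hij⟩ := exists_facet_lift hT hQ hext hq₀ j
    obtain ⟨W, -, hW, hWk⟩ := hP.2 i
    obtain ⟨T', hT', hext'⟩ := exists_realization_slackWedge hT hQ hext hij hW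
    have hproper := slackWedge_isProper hQ j
    exact ⟨Q.slackWedge j, hproper, slackWedge_isWedgeOver hQ j,
      ih W hWk (by omega) (by omega) _ hproper T' hT' hext'⟩

/-- Lemma 11: any `d'`-dimensional face `F` of a
`k`-wedge-simple `d`-dimensional polyhedron `P`, with `1 < d' < d`, is itself
`k`-wedge-simple (in any proper realization of `F` as a full-dimensional
polyhedron in `ℝ^{d'}`). -/
theorem face_of_kWedgeSimple_is_kWedgeSimple {d f d' f' : ℕ} (k : ℕ) (hk : 1 ≤ k)
    (P : PolyData d f) (hP : P.IsProper) (hws : IsKWedgeSimple k P)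
    (S : Set (Fin f)) (F : Set (Fin d → ℝ))
    (hF : F = {z ∈ P.toSet | S ⊆ P.activeAt z})
    (hd1 : 1 < d') (hd2 : d' < d)
    (hdim : Module.finrank ℝ (affineSpan ℝ F).direction = d')
    (Q : PolyData d' f') (hQ : Q.IsProper)
    (T : (Fin d' → ℝ) →ᵃ[ℝ] (Fin d → ℝ)) (hT : Function.Injective T)
    (hTQ : T '' Q.toSet = F) :
    IsKWedgeSimple k Q := by
  exact IsKWedgeSimpleAux.of_face k P hws hd2 hd1 Q hQ T hT
    (by rw [hTQ, hF]; exact P.isExtreme_face S)
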